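/- Let V₁,…,V_m be real n×n symmetric positive definite matrices and y ∈ ℝⁿ with y ≠ 0. For σ² with nonnegative entries, σ² ≠ 0, let Ω(σ²) = Σᵢ σᵢ² Vᵢ, and define the MM map M by (M(σ²))ᵢ = σᵢ²·√( (yᵀΩ(σ²)⁻¹VᵢΩ(σ²)⁻¹y) / tr(Ω(σ²)⁻¹Vᵢ) ), with (M(σ²))ᵢ = 0 when σᵢ² = 0. Let σ²⁽⁰⁾ have all entries strictly positive and define σ²⁽ᵗ⁺¹⁾ = M(σ²⁽ᵗ⁾). Then the sequence { σ²⁽ᵗ⁾ } has at least one limit point, and every limit point σ*² of the sequence is a fixed point of M: M(σ*²) = σ*². -/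

import Mathlib

open Matrix

/-- The covariance matrix `Ω(σ²) = ∑ i, σᵢ² Vᵢ`. -/
noncomputable def covMat {m n : ℕ} (V : Fin m → Matrix (Fin n) (Fin n) ℝ)
    (s : Fin m → ℝ) : Matrix (Fin n) (Fin n) ℝ :=
  ∑ i, s i • V i

/-- The MM map `(M(σ²))ᵢ = σᵢ² √( (yᵀΩ⁻¹VᵢΩ⁻¹y) / tr(Ω⁻¹Vᵢ) )` (which is `0` whenever
`σᵢ² = 0`). -/
noncomputable def mmMap {m n : ℕ} (V : Fin m → Matrix (Fin n) (Fin n) ℝ)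
    (y : Fin n → ℝ) (s : Fin m → ℝ) : Fin m → ℝ := fun i =>
  s i * Real.sqrt ((y ⬝ᵥ ((covMat V s)⁻¹ * V i * (covMat V s)⁻¹) *ᵥ y) /
    ((covMat V s)⁻¹ * V i).trace)

open scoped MatrixOrder in
/-- The product of two real positive definite matrices is similar to a positive definite matrix. -/
lemma Matrix.PosDef.exists_posDef_trace_det_mul {n : ℕ} {P B : Matrix (Fin n) (Fin n) ℝ}
    (hP : P.PosDef) (hB : B.PosDef) :
    ∃ X : Matrix (Fin n) (Fin n) ℝ,
      X.PosDef ∧ X.trace = (P * B).trace ∧ X.det = (P * B).det := by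
  obtain ⟨C, hC⟩ := CStarAlgebra.nonneg_iff_eq_star_mul_self.mp hP.posSemidef.nonneg
  rw [star_eq_conjTranspose] at hC
  have hunit : IsUnit C := by
    have h := hP.isUnit
    rw [hC] at h
    exact isUnit_of_mul_isUnit_right h
  refine ⟨C * B * Cᴴ, ?_, ?_, ?_⟩
  · exact hB.mul_mul_conjTranspose_same (vecMul_injective_iff_isUnit.mpr hunit)
  · rw [hC, trace_mul_comm, ← Matrix.mul_assoc]
  · rw [hC]
    simp only [det_mul]
    ring

lemma Matrix.PosDef.trace_mul_pos {n : ℕ} [NeZero n] {P B : Matrix (Fin n) (Fin n) ℝ}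
    (hP : P.PosDef) (hB : B.PosDef) : 0 < (P * B).trace := by
  obtain ⟨X, hX, htr, -⟩ := hP.exists_posDef_trace_det_mul hB
  exact htr ▸ hX.trace_pos

lemma Matrix.PosDef.log_det_le_trace_sub {n : ℕ} {X : Matrix (Fin n) (Fin n) ℝ}
    (hX : X.PosDef) : Real.log X.det ≤ X.trace - n := by
  have hdet := hX.isHermitian.det_eq_prod_eigenvalues
  have htr := hX.isHermitian.trace_eq_sum_eigenvalues
  simp only [RCLike.ofReal_real_eq_id, id_eq] at hdet htr
  rw [hdet, htr, Real.log_prod fun i _ => (hX.eigenvalues_pos i).ne']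
  calc ∑ i, Real.log (hX.isHermitian.eigenvalues i)
      ≤ ∑ i, (hX.isHermitian.eigenvalues i - 1) :=
        Finset.sum_le_sum fun i _ => Real.log_le_sub_one_of_pos (hX.eigenvalues_pos i)
    _ = _ := by simp

/-- Concavity of `log det`: its graph lies below its tangent plane at `A`. -/
lemma Matrix.PosDef.log_det_le_log_det_add {n : ℕ} {A B : Matrix (Fin n) (Fin n) ℝ}
    (hA : A.PosDef) (hB : B.PosDef) :
    Real.log B.det ≤ Real.log A.det + ((A⁻¹ * B).trace - n) := by
  obtain ⟨X, hX, htr, hdet⟩ := hA.inv.exists_posDef_trace_det_mul hB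
  have h := hX.log_det_le_trace_sub
  rw [htr, hdet, det_mul, Real.log_mul hA.inv.det_pos.ne' hB.det_pos.ne', det_nonsing_inv,
    Ring.inverse_eq_inv', Real.log_inv] at h
  linarith

/-- The coefficient `tr(Ω⁻¹Vᵢ)`. -/
noncomputable def traceCoeff {m n : ℕ} (V : Fin m → Matrix (Fin n) (Fin n) ℝ)
    (s : Fin m → ℝ) (i : Fin m) : ℝ :=
  ((covMat V s)⁻¹ * V i).trace

/-- The coefficient `yᵀΩ⁻¹VᵢΩ⁻¹y`. -/
noncomputable def quadCoeff {m n : ℕ} (V : Fin m → Matrix (Fin n) (Fin n) ℝ)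
    (y : Fin n → ℝ) (s : Fin m → ℝ) (i : Fin m) : ℝ :=
  y ⬝ᵥ ((covMat V s)⁻¹ * V i * (covMat V s)⁻¹) *ᵥ y

/-- Up to affine normalization, the negative Gaussian log-likelihood `log det Ω + yᵀΩ⁻¹y`. -/
noncomputable def negLogLik {m n : ℕ} (V : Fin m → Matrix (Fin n) (Fin n) ℝ)
    (y : Fin n → ℝ) (s : Fin m → ℝ) : ℝ :=
  Real.log (covMat V s).det + y ⬝ᵥ (covMat V s)⁻¹ *ᵥ y

/-- The decrease of the surrogate function in one MM step. -/
noncomputable def mmDecrease {m n : ℕ} (V : Fin m → Matrix (Fin n) (Fin n) ℝ)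
    (y : Fin n → ℝ) (s : Fin m → ℝ) : ℝ :=
  ∑ i, s i * (√(traceCoeff V s i) - √(quadCoeff V y s i)) ^ 2

section

variable {m n : ℕ} {V : Fin m → Matrix (Fin n) (Fin n) ℝ} {y : Fin n → ℝ} {s : Fin m → ℝ}

lemma mmMap_apply (i : Fin m) :
    mmMap V y s i = s i * √(quadCoeff V y s i / traceCoeff V s i) := rfl

lemma dotProduct_covMat_mulVec (x z : Fin n → ℝ) :
    x ⬝ᵥ covMat V s *ᵥ z = ∑ i, s i * (x ⬝ᵥ V i *ᵥ z) := by
  simp [covMat, sum_mulVec, dotProduct_sum, smul_mulVec]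

lemma sum_pos_of_nonneg (hs : 0 ≤ s) (h : s ≠ 0) : 0 < ∑ i, s i :=
  Fintype.sum_pos (lt_of_le_of_ne hs h.symm)

lemma ne_zero_of_sum_pos (h : 0 < ∑ i, s i) : s ≠ 0 := by
  rintro rfl
  simp at h

lemma posDef_covMat (hV : ∀ i, (V i).PosDef) (hs : 0 ≤ s) (h : s ≠ 0) : (covMat V s).PosDef := by
  refine .of_dotProduct_mulVec_pos ?_ fun x hx => ?_
  · exact (posSemidef_sum _ fun i _ => (hV i).posSemidef.smul (hs i)).isHermitian
  · rw [dotProduct_covMat_mulVec]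
    obtain ⟨j, hj⟩ := Function.ne_iff.mp h
    have hq : ∀ i, 0 < star x ⬝ᵥ V i *ᵥ x := fun i => (hV i).dotProduct_mulVec_pos hx
    exact Finset.sum_pos' (fun i _ => mul_nonneg (hs i) (hq i).le)
      ⟨j, Finset.mem_univ j, mul_pos (lt_of_le_of_ne (hs j) hj.symm) (hq j)⟩

lemma traceCoeff_pos [NeZero n] (hV : ∀ i, (V i).PosDef) (hs : 0 ≤ s) (h : s ≠ 0) (i : Fin m) :
    0 < traceCoeff V s i :=
  (posDef_covMat hV hs h).inv.trace_mul_pos (hV i)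

lemma quadCoeff_pos (hV : ∀ i, (V i).PosDef) (hy : y ≠ 0) (hs : 0 ≤ s) (h : s ≠ 0)
    (i : Fin m) : 0 < quadCoeff V y s i := by
  have hΩ := (posDef_covMat hV hs h).inv
  have := (hV i).conjTranspose_mul_mul_same (mulVec_injective_iff_isUnit.mpr hΩ.isUnit)
  rw [hΩ.isHermitian.eq] at this
  exact this.dotProduct_mulVec_pos hy

lemma continuousAt_inv_covMat (hV : ∀ i, (V i).PosDef) (hs : 0 ≤ s) (h : s ≠ 0) :
    ContinuousAt (fun u => (covMat V u)⁻¹) s := by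
  have hdet := (posDef_covMat hV hs h).det_pos.ne'
  have hinv : ContinuousAt Inv.inv (covMat V s) := by
    apply continuousAt_matrix_inv
    rw [Ring.inverse_eq_inv']
    exact continuousAt_inv₀ hdet
  have hc : Continuous fun u => covMat V u := by
    unfold covMat
    fun_prop
  exact ContinuousAt.comp (f := fun u => covMat V u) hinv hc.continuousAt

lemma continuousAt_traceCoeff (hV : ∀ i, (V i).PosDef) (hs : 0 ≤ s) (h : s ≠ 0) (i : Fin m) :
    ContinuousAt (fun u => traceCoeff V u i) s := by
  have hc : Continuous fun W : Matrix (Fin n) (Fin n) ℝ => (W * V i).trace := by fun_prop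
  exact hc.continuousAt.comp (continuousAt_inv_covMat hV hs h)

lemma continuousAt_quadCoeff (hV : ∀ i, (V i).PosDef) (hs : 0 ≤ s) (h : s ≠ 0) (i : Fin m) :
    ContinuousAt (fun u => quadCoeff V y u i) s := by
  have hc : Continuous fun W : Matrix (Fin n) (Fin n) ℝ => y ⬝ᵥ (W * V i * W) *ᵥ y := by
    fun_prop
  exact hc.continuousAt.comp (continuousAt_inv_covMat hV hs h)

lemma continuousAt_negLogLik (hV : ∀ i, (V i).PosDef) (hs : 0 ≤ s) (h : s ≠ 0) :
    ContinuousAt (negLogLik V y) s := by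
  have hc : Continuous fun W : Matrix (Fin n) (Fin n) ℝ => y ⬝ᵥ W *ᵥ y := by fun_prop
  have hd : Continuous fun u => (covMat V u).det := by
    unfold covMat
    fun_prop
  exact (hd.continuousAt.log (posDef_covMat hV hs h).det_pos.ne').add
    (hc.continuousAt.comp (continuousAt_inv_covMat hV hs h))

lemma continuousAt_mmDecrease (hV : ∀ i, (V i).PosDef) (hs : 0 ≤ s) (h : s ≠ 0) :
    ContinuousAt (mmDecrease V y) s := by
  unfold mmDecrease
  refine tendsto_finsetSum _ fun i _ => ?_
  exact (continuous_apply i).continuousAt.mul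
    (((continuousAt_traceCoeff hV hs h i).sqrt.sub (continuousAt_quadCoeff hV hs h i).sqrt).pow 2)

lemma continuousAt_mmMap [NeZero n] (hV : ∀ i, (V i).PosDef) (hs : 0 ≤ s) (h : s ≠ 0) :
    ContinuousAt (mmMap V y) s := by
  refine continuousAt_pi.mpr fun i => ?_
  exact (continuous_apply i).continuousAt.mul
    ((continuousAt_quadCoeff hV hs h i).div (continuousAt_traceCoeff hV hs h i)
      (traceCoeff_pos hV hs h i).ne').sqrt

lemma mmMap_pos [NeZero n] (hV : ∀ i, (V i).PosDef) (hy : y ≠ 0) (hs : 0 ≤ s) {i : Fin m}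
    (hi : 0 < s i) : 0 < mmMap V y s i := by
  have h : s ≠ 0 := fun h => by simp [h] at hi
  exact mul_pos hi (Real.sqrt_pos.mpr
    (div_pos (quadCoeff_pos hV hy hs h i) (traceCoeff_pos hV hs h i)))

lemma mmMap_nonneg (hs : 0 ≤ s) : 0 ≤ mmMap V y s :=
  fun i => mul_nonneg (hs i) (Real.sqrt_nonneg _)

/-- The MM map is positively homogeneous of degree `1 / 2`. -/
lemma mmMap_smul {r : ℝ} (hr : 0 < r) : mmMap V y (r • s) = √r • mmMap V y s := by
  have hcov : covMat V (r • s) = r • covMat V s := by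
    simp [covMat, Finset.smul_sum, mul_smul]
  have hinv : (covMat V (r • s))⁻¹ = r⁻¹ • (covMat V s)⁻¹ := by
    by_cases hdet : IsUnit (covMat V s).det
    · rw [hcov]
      exact inv_smul' _ (Units.mk0 r hr.ne') hdet
    · have hdet' : ¬ IsUnit (r • covMat V s).det := by
        simpa [det_smul, hr.ne'] using hdet
      rw [hcov, nonsing_inv_apply_not_isUnit _ hdet, nonsing_inv_apply_not_isUnit _ hdet',
        smul_zero]
  ext i
  have ha : traceCoeff V (r • s) i = r⁻¹ * traceCoeff V s i := by
    simp [traceCoeff, hinv]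
  have hb : quadCoeff V y (r • s) i = r⁻¹ * (r⁻¹ * quadCoeff V y s i) := by
    simp [quadCoeff, hinv, smul_mulVec]
  rw [Pi.smul_apply, smul_eq_mul, mmMap_apply, mmMap_apply, ha, hb,
    mul_div_mul_left _ _ (inv_ne_zero hr.ne'), mul_div_assoc, Real.sqrt_mul (inv_nonneg.mpr hr.le),
    Real.sqrt_inv, Pi.smul_apply, smul_eq_mul]
  nth_rewrite 1 [← Real.mul_self_sqrt hr.le]
  have := (Real.sqrt_pos.mpr hr).ne'
  field_simp

lemma exists_sum_mmMap_bounds [NeZero n] (hV : ∀ i, (V i).PosDef) (hy : y ≠ 0) :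
    ∃ c C : ℝ, 0 < c ∧ ∀ s : Fin m → ℝ, 0 ≤ s → s ≠ 0 →
      c * √(∑ i, s i) ≤ ∑ i, mmMap V y s i ∧ ∑ i, mmMap V y s i ≤ C * √(∑ i, s i) := by
  have hne : ∀ p ∈ stdSimplex ℝ (Fin m), p ≠ 0 := fun p hp =>
    ne_zero_of_sum_pos (by rw [hp.2]; exact one_pos)
  have hcont : ContinuousOn (fun p => ∑ i, mmMap V y p i) (stdSimplex ℝ (Fin m)) := fun p hp =>
    ContinuousAt.continuousWithinAt <| tendsto_finsetSum _ fun i _ =>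
      (continuous_apply i).continuousAt.comp (continuousAt_mmMap hV hp.1 (hne p hp))
  have hpos : ∀ p ∈ stdSimplex ℝ (Fin m), 0 < ∑ i, mmMap V y p i := fun p hp => by
    obtain ⟨j, hj⟩ := Function.ne_iff.mp (hne p hp)
    exact Finset.sum_pos' (fun i _ => mmMap_nonneg hp.1 i)
      ⟨j, Finset.mem_univ j, mmMap_pos hV hy hp.1 (lt_of_le_of_ne (hp.1 j) hj.symm)⟩
  obtain ⟨c, hc, hcle⟩ := (isCompact_stdSimplex ℝ (Fin m)).exists_forall_le' hcont hpos
  obtain ⟨C, hC⟩ := (isCompact_stdSimplex ℝ (Fin m)).bddAbove_image hcont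
  refine ⟨c, C, hc, fun s hs h => ?_⟩
  have hr := sum_pos_of_nonneg hs h
  set r := ∑ i, s i with hr_def
  have hp : r⁻¹ • s ∈ stdSimplex ℝ (Fin m) := by
    refine ⟨fun i => mul_nonneg (inv_nonneg.mpr hr.le) (hs i), ?_⟩
    simp [← Finset.mul_sum, ← hr_def, hr.ne']
  have hsum : ∑ i, mmMap V y s i = (∑ i, mmMap V y (r⁻¹ • s) i) * √r := by
    conv_lhs => rw [← smul_inv_smul₀ hr.ne' s, mmMap_smul hr]
    simp [← Finset.mul_sum, mul_comm]
  rw [hsum]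
  exact ⟨mul_le_mul_of_nonneg_right (hcle _ hp) (Real.sqrt_nonneg r),
    mul_le_mul_of_nonneg_right (hC ⟨_, hp, rfl⟩) (Real.sqrt_nonneg r)⟩

lemma trace_inv_covMat_mul_covMat (u : Fin m → ℝ) :
    ((covMat V s)⁻¹ * covMat V u).trace = ∑ i, u i * traceCoeff V s i := by
  simp only [traceCoeff]
  conv_lhs => rw [covMat.eq_1 V u]
  simp [Finset.mul_sum, trace_sum]

/-- Convexity bound for the quadratic part of the likelihood. -/
lemma dotProduct_inv_covMat_mulVec_le {u : Fin m → ℝ} (hV : ∀ i, (V i).PosDef) (hs : 0 ≤ s)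
    (h : s ≠ 0) (hu : ∀ i, 0 < u i) (hu0 : u ≠ 0) :
    y ⬝ᵥ (covMat V u)⁻¹ *ᵥ y ≤ ∑ i, s i ^ 2 / u i * quadCoeff V y s i := by
  have hΩs := posDef_covMat hV hs h
  have hΩu := posDef_covMat hV (fun i => (hu i).le) hu0
  set z := (covMat V s)⁻¹ *ᵥ y with hz
  set x := (covMat V u)⁻¹ *ᵥ y with hx
  have hyz : covMat V s *ᵥ z = y := by
    rw [hz, mulVec_mulVec, mul_nonsing_inv _ hΩs.det_pos.ne'.isUnit, one_mulVec]
  have hyx : covMat V u *ᵥ x = y := by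
    rw [hx, mulVec_mulVec, mul_nonsing_inv _ hΩu.det_pos.ne'.isUnit, one_mulVec]
  have hxz : x ⬝ᵥ y = ∑ i, s i * (x ⬝ᵥ V i *ᵥ z) := by
    rw [← dotProduct_covMat_mulVec, hyz]
  have hxx : x ⬝ᵥ y = ∑ i, u i * (x ⬝ᵥ V i *ᵥ x) := by
    rw [← dotProduct_covMat_mulVec, hyx]
  have hquad : ∀ i, quadCoeff V y s i = z ⬝ᵥ V i *ᵥ z := fun i => by
    have hsymm : (covMat V s)⁻¹ᵀ = (covMat V s)⁻¹ := hΩs.inv.isHermitian.eq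
    rw [quadCoeff, ← mulVec_mulVec, ← mulVec_mulVec, ← hz, dotProduct_mulVec, ← mulVec_transpose,
      hsymm]
  have hterm : ∀ i, 2 * (s i * (x ⬝ᵥ V i *ᵥ z)) - u i * (x ⬝ᵥ V i *ᵥ x) ≤
      s i ^ 2 / u i * quadCoeff V y s i := fun i => by
    have hsymm : z ⬝ᵥ V i *ᵥ x = x ⬝ᵥ V i *ᵥ z := by
      have hVi : (V i)ᵀ = V i := (hV i).isHermitian.eq
      rw [dotProduct_mulVec, ← mulVec_transpose, hVi, dotProduct_comm]
    have hnn : 0 ≤ (u i • x - s i • z) ⬝ᵥ V i *ᵥ (u i • x - s i • z) :=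
      (hV i).posSemidef.dotProduct_mulVec_nonneg _
    simp only [mulVec_sub, mulVec_smul, dotProduct_sub, sub_dotProduct, smul_dotProduct,
      dotProduct_smul, smul_eq_mul, hsymm] at hnn
    rw [hquad, div_mul_eq_mul_div, le_div_iff₀ (hu i)]
    linarith
  calc y ⬝ᵥ x = 2 * (x ⬝ᵥ y) - x ⬝ᵥ y := by rw [dotProduct_comm]; ring
    _ = ∑ i, (2 * (s i * (x ⬝ᵥ V i *ᵥ z)) - u i * (x ⬝ᵥ V i *ᵥ x)) := by
      rw [Finset.sum_sub_distrib, ← Finset.mul_sum, ← hxz, ← hxx]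
    _ ≤ _ := Finset.sum_le_sum fun i _ => hterm i

lemma sum_mul_traceCoeff (hV : ∀ i, (V i).PosDef) (hs : 0 ≤ s) (h : s ≠ 0) :
    ∑ i, s i * traceCoeff V s i = n := by
  rw [← trace_inv_covMat_mul_covMat,
    nonsing_inv_mul _ (posDef_covMat hV hs h).det_pos.ne'.isUnit]
  simp

lemma sum_mul_quadCoeff (hV : ∀ i, (V i).PosDef) (hs : 0 ≤ s) (h : s ≠ 0) :
    ∑ i, s i * quadCoeff V y s i = y ⬝ᵥ (covMat V s)⁻¹ *ᵥ y := by
  have hΩ := posDef_covMat hV hs h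
  have hsum : ∑ i, s i * quadCoeff V y s i =
      y ⬝ᵥ ((covMat V s)⁻¹ * covMat V s * (covMat V s)⁻¹) *ᵥ y := by
    simp only [quadCoeff]
    generalize (covMat V s)⁻¹ = W
    simp [covMat, Finset.mul_sum, Finset.sum_mul, sum_mulVec, dotProduct_sum, smul_mulVec]
  rw [hsum, nonsing_inv_mul _ hΩ.det_pos.ne'.isUnit, Matrix.one_mul]

/-- The descent property of the MM map. -/
lemma negLogLik_mmMap_le [NeZero n] (hV : ∀ i, (V i).PosDef) (hy : y ≠ 0)
    (hpos : ∀ i, 0 < s i) (h : s ≠ 0) :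
    negLogLik V y (mmMap V y s) ≤ negLogLik V y s - mmDecrease V y s := by
  have hs : 0 ≤ s := fun i => (hpos i).le
  have hu : ∀ i, 0 < mmMap V y s i := fun i => mmMap_pos hV hy hs (hpos i)
  have hu0 : mmMap V y s ≠ 0 := by
    obtain ⟨j, -⟩ := Function.ne_iff.mp h
    exact Function.ne_iff.mpr ⟨j, (hu j).ne'⟩
  have hlog := (posDef_covMat hV hs h).log_det_le_log_det_add
    (posDef_covMat hV (fun i => (hu i).le) hu0)
  have hquad := dotProduct_inv_covMat_mulVec_le (y := y) hV hs h hu hu0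
  rw [trace_inv_covMat_mul_covMat, ← sum_mul_traceCoeff hV hs h] at hlog
  have hterm : ∀ i, mmMap V y s i * traceCoeff V s i +
      s i ^ 2 / mmMap V y s i * quadCoeff V y s i =
      s i * traceCoeff V s i + s i * quadCoeff V y s i -
        s i * (√(traceCoeff V s i) - √(quadCoeff V y s i)) ^ 2 := fun i => by
    have ha := traceCoeff_pos hV hs h i
    have hb := quadCoeff_pos hV hy hs h i
    rw [mmMap_apply, Real.sqrt_div hb.le]
    have hsi := (hpos i).ne'
    generalize traceCoeff V s i = a at *
    generalize quadCoeff V y s i = b at *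
    obtain ⟨p, hp, rfl⟩ : ∃ p, 0 < p ∧ p ^ 2 = a :=
      ⟨√a, Real.sqrt_pos.mpr ha, Real.sq_sqrt ha.le⟩
    obtain ⟨q, hq, rfl⟩ : ∃ q, 0 < q ∧ q ^ 2 = b :=
      ⟨√b, Real.sqrt_pos.mpr hb, Real.sq_sqrt hb.le⟩
    rw [Real.sqrt_sq hp.le, Real.sqrt_sq hq.le]
    field_simp
    ring
  have hsum := Finset.sum_congr rfl fun i (_ : i ∈ Finset.univ) => hterm i
  rw [Finset.sum_add_distrib, Finset.sum_sub_distrib, Finset.sum_add_distrib,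
    sum_mul_quadCoeff hV hs h] at hsum
  unfold negLogLik mmDecrease
  linarith

lemma mmDecrease_nonneg (hs : 0 ≤ s) : 0 ≤ mmDecrease V y s :=
  Finset.sum_nonneg fun i _ => mul_nonneg (hs i) (sq_nonneg _)

lemma mmMap_eq_self_of_mmDecrease_eq_zero [NeZero n] (hV : ∀ i, (V i).PosDef) (hy : y ≠ 0)
    (hs : 0 ≤ s) (h : s ≠ 0) (hdec : mmDecrease V y s = 0) : mmMap V y s = s := by
  ext i
  have hi := (Finset.sum_eq_zero_iff_of_nonneg
    fun j _ => mul_nonneg (hs j) (sq_nonneg _)).mp hdec i (Finset.mem_univ i)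
  have ha := traceCoeff_pos hV hs h i
  have hb := quadCoeff_pos hV hy hs h i
  rw [mmMap_apply]
  rcases mul_eq_zero.mp hi with hi | hi
  · simp [hi]
  · have hab := sub_eq_zero.mp (pow_eq_zero_iff two_ne_zero |>.mp hi)
    rw [Real.sqrt_inj ha.le hb.le] at hab
    rw [← hab, div_self ha.ne', Real.sqrt_one, mul_one]

end

/-- A compact set of nonzero nonnegative vectors that contains the whole MM sequence. -/
lemma exists_isCompact_forall_mem_of_mmMap {m n : ℕ} [NeZero n]
    {V : Fin m → Matrix (Fin n) (Fin n) ℝ} (hV : ∀ i, (V i).PosDef) {y : Fin n → ℝ}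
    (hy : y ≠ 0) {s : ℕ → Fin m → ℝ} (hpos : ∀ t i, 0 < s t i) (h : ∀ t, s t ≠ 0)
    (hrec : ∀ t, s (t + 1) = mmMap V y (s t)) :
    ∃ K : Set (Fin m → ℝ), IsCompact K ∧ (∀ w ∈ K, 0 ≤ w ∧ w ≠ 0) ∧ ∀ t, s t ∈ K := by
  obtain ⟨c, C, hc, hcC⟩ := exists_sum_mmMap_bounds hV hy (m := m)
  have hs : ∀ t, 0 ≤ s t := fun t i => (hpos t i).le
  have hr0 : 0 < ∑ i, s 0 i := sum_pos_of_nonneg (hs 0) (h 0)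
  set α := min (∑ i, s 0 i) (c ^ 2) with hα_def
  set β := max (∑ i, s 0 i) (C ^ 2) with hβ_def
  have hα : 0 < α := lt_min hr0 (by positivity)
  have hβ : 0 < β := lt_max_of_lt_left hr0
  have hbound : ∀ t, α ≤ ∑ i, s t i ∧ ∑ i, s t i ≤ β := by
    intro t
    induction t with
    | zero => exact ⟨min_le_left _ _, le_max_left _ _⟩
    | succ t ih =>
      obtain ⟨hlo, hhi⟩ := hcC (s t) (hs t) (h t)
      rw [hrec]
      have hαc : √α ≤ c := Real.sqrt_le_iff.mpr ⟨hc.le, min_le_right _ _⟩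
      have hCβ : C ≤ √β := Real.le_sqrt_of_sq_le (le_max_right _ _)
      constructor
      · calc α = √α * √α := (Real.mul_self_sqrt hα.le).symm
          _ ≤ c * √(∑ i, s t i) :=
            mul_le_mul hαc (Real.sqrt_le_sqrt ih.1) (Real.sqrt_nonneg _) hc.le
          _ ≤ _ := hlo
      · calc _ ≤ C * √(∑ i, s t i) := hhi
          _ ≤ √β * √β :=
            mul_le_mul hCβ (Real.sqrt_le_sqrt ih.2) (Real.sqrt_nonneg _) (Real.sqrt_nonneg _)
          _ = β := Real.mul_self_sqrt hβ.le
  have hsum : Continuous fun w : Fin m → ℝ => ∑ i, w i := by fun_prop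
  refine ⟨Set.Icc 0 (fun _ => β) ∩ {w | α ≤ ∑ i, w i},
    isCompact_Icc.inter_right (isClosed_le continuous_const hsum), ?_, fun t => ?_⟩
  · exact fun w hw => ⟨hw.1.1, ne_zero_of_sum_pos (hα.trans_le hw.2)⟩
  · refine ⟨⟨hs t, fun i => ?_⟩, (hbound t).1⟩
    exact (Finset.single_le_sum (fun j _ => hs t j) (Finset.mem_univ i)).trans (hbound t).2

/-- the MM sequence has at least one limit point, and every limit
point is a fixed point of the MM map. -/
theorem mm_limit_points_are_fixed_points (m n : ℕ)
    (V : Fin m → Matrix (Fin n) (Fin n) ℝ) (hV : ∀ i, (V i).PosDef)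
    (y : Fin n → ℝ) (hy : y ≠ 0) (s : ℕ → Fin m → ℝ)
    (h0 : ∀ i, 0 < s 0 i) (hrec : ∀ t, s (t + 1) = mmMap V y (s t)) :
    (∃ w : Fin m → ℝ, ∃ φ : ℕ → ℕ, StrictMono φ ∧
      Filter.Tendsto (fun k => s (φ k)) Filter.atTop (nhds w)) ∧
    ∀ w : Fin m → ℝ, (∃ φ : ℕ → ℕ, StrictMono φ ∧
      Filter.Tendsto (fun k => s (φ k)) Filter.atTop (nhds w)) →
      mmMap V y w = w := by
  have : NeZero n := ⟨by rintro rfl; exact hy (Subsingleton.elim _ _)⟩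
  rcases Nat.eq_zero_or_pos m with rfl | hm
  · exact ⟨⟨0, id, strictMono_id, by
      simp [Subsingleton.elim s fun _ => 0]⟩,
      fun w _ => Subsingleton.elim _ _⟩
  have hpos : ∀ t i, 0 < s t i := by
    intro t
    induction t with
    | zero => exact h0
    | succ t ih =>
      intro i
      rw [hrec]
      exact mmMap_pos hV hy (fun j => (ih j).le) (ih i)
  have hne : ∀ t, s t ≠ 0 := fun t => Function.ne_iff.mpr ⟨⟨0, hm⟩, (hpos t _).ne'⟩
  obtain ⟨K, hK, hKne, hmem⟩ := exists_isCompact_forall_mem_of_mmMap hV hy hpos hne hrec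
  have hdec : ∀ t, mmDecrease V y (s t) ≤ negLogLik V y (s t) - negLogLik V y (s (t + 1)) := by
    intro t
    have := negLogLik_mmMap_le hV hy (hpos t) (hne t)
    rw [← hrec] at this
    linarith
  have hanti : Antitone fun t => negLogLik V y (s t) := antitone_nat_of_succ_le fun t => by
    linarith [hdec t, mmDecrease_nonneg (V := V) (y := y) fun i => (hpos t i).le]
  have hbdd : BddBelow (Set.range fun t => negLogLik V y (s t)) := by
    refine (hK.bddBelow_image (f := negLogLik V y) fun w hw =>
      (continuousAt_negLogLik hV (hKne w hw).1 (hKne w hw).2).continuousWithinAt).mono ?_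
    rintro _ ⟨t, rfl⟩
    exact ⟨s t, hmem t, rfl⟩
  have hlim := tendsto_atTop_ciInf hanti hbdd
  have hzero : Filter.Tendsto (fun t => mmDecrease V y (s t)) Filter.atTop (nhds 0) := by
    refine squeeze_zero (fun t => mmDecrease_nonneg fun i => (hpos t i).le) hdec ?_
    simpa using hlim.sub (hlim.comp (Filter.tendsto_add_atTop_nat 1))
  constructor
  · obtain ⟨w, -, φ, hφ, hw⟩ := hK.tendsto_subseq hmem
    exact ⟨w, φ, hφ, hw⟩
  · rintro w ⟨φ, hφ, hw⟩
    obtain ⟨hw0, hwne⟩ := hKne w (hK.isClosed.mem_of_tendsto hw (.of_forall fun k => hmem (φ k)))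
    refine mmMap_eq_self_of_mmDecrease_eq_zero hV hy hw0 hwne ?_
    exact tendsto_nhds_unique ((continuousAt_mmDecrease hV hw0 hwne).tendsto.comp hw)
      (hzero.comp hφ.tendsto_atTop)
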